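/- arXiv:1402.3336 — 8 statements merged into one kernel-verified Lean document; each statement's English description precedes it below -/
import Mathlib

section
/- For every n ≥ 1 and every pattern π of length 3 (i.e., every permutation of {1,2,3}), the number of Latin squares of order n all of whose rows and columns avoid π is exactly n. -/
/-- A Latin square of order `n`: every row map and every column map is a bijection. -/
def IsLatinSquare {n : ℕ} (L : Fin n → Fin n → Fin n) : Prop :=
  (∀ i, Function.Bijective fun j => L i j) ∧ ∀ j, Function.Bijective fun i => L i j

/-- `f` contains the pattern `π`: there are strictly increasing indices whose values
are order isomorphic to `π`. -/
def ContainsPattern {n k : ℕ} (f : Fin n → Fin n) (π : Equiv.Perm (Fin k)) : Prop :=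
  ∃ idx : Fin k → Fin n, StrictMono idx ∧ ∀ a b, f (idx a) < f (idx b) ↔ π a < π b

/-- `f` avoids the pattern `π`. -/
def AvoidsPattern {n k : ℕ} (f : Fin n → Fin n) (π : Equiv.Perm (Fin k)) : Prop :=
  ¬ ContainsPattern f π

/-- A Latin square avoids `π` if all row maps and all column maps avoid `π`. -/
def LatinAvoids {n k : ℕ} (L : Fin n → Fin n → Fin n) (π : Equiv.Perm (Fin k)) : Prop :=
  (∀ i, AvoidsPattern (fun j => L i j) π) ∧ ∀ j, AvoidsPattern (fun i => L i j) π


/-- The pattern 123 (identity permutation of `Fin 3`). -/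
def pat123 : Equiv.Perm (Fin 3) := Equiv.refl _
/-- The pattern 231 in one-line notation (0-indexed: 0↦1, 1↦2, 2↦0). -/
def pat231 : Equiv.Perm (Fin 3) := ⟨![1,2,0], ![2,0,1], by decide, by decide⟩
/-- The pattern 312 in one-line notation (0-indexed: 0↦2, 1↦0, 2↦1). -/
def pat312 : Equiv.Perm (Fin 3) := ⟨![2,0,1], ![1,2,0], by decide, by decide⟩
/-- The pattern 321 in one-line notation (0-indexed: 0↦2, 1↦1, 2↦0). -/
def pat321 : Equiv.Perm (Fin 3) := ⟨![2,1,0], ![2,1,0], by decide, by decide⟩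
/-- The pattern 132 in one-line notation (0-indexed: 0↦0, 1↦2, 2↦1). -/
def pat132 : Equiv.Perm (Fin 3) := ⟨![0,2,1], ![0,2,1], by decide, by decide⟩
/-- The pattern 213 in one-line notation (0-indexed: 0↦1, 1↦0, 2↦2). -/
def pat213 : Equiv.Perm (Fin 3) := ⟨![1,0,2], ![1,0,2], by decide, by decide⟩

/-- `LatinAvoiding π L`: the Latin square `L` avoids `π` in all rows and columns. -/
def LatinAvoiding {n k : ℕ} (π : Equiv.Perm (Fin k)) (L : Fin n → Fin n → Fin n) : Prop :=
  IsLatinSquare L ∧ LatinAvoids L π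

section Symmetries

variable {n k : ℕ}

theorem ContainsPattern.complement {f : Fin n → Fin n} {π : Equiv.Perm (Fin k)}
    (h : ContainsPattern f π) :
    ContainsPattern (fun x => (f x).rev) (π.trans Fin.revPerm) := by
  obtain ⟨idx, hm, h⟩ := h
  exact ⟨idx, hm, fun a b => by simpa using h b a⟩

theorem ContainsPattern.reverse {f : Fin n → Fin n} {π : Equiv.Perm (Fin k)}
    (h : ContainsPattern f π) :
    ContainsPattern (fun x : Fin n => f x.rev) (Fin.revPerm.trans π) := by
  obtain ⟨idx, hm, h⟩ := h
  refine ⟨fun a => (idx a.rev).rev, fun a b hab => ?_, fun a b => by simpa using h a.rev b.rev⟩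
  simpa using hm (Fin.rev_lt_rev.2 hab)

theorem avoidsPattern_complement {f : Fin n → Fin n} {π : Equiv.Perm (Fin k)} :
    AvoidsPattern (fun x => (f x).rev) (π.trans Fin.revPerm) ↔ AvoidsPattern f π := by
  refine not_congr ⟨fun h => ?_, ContainsPattern.complement⟩
  have hπ : (π.trans Fin.revPerm).trans Fin.revPerm = π := by ext; simp
  simpa [hπ] using h.complement

theorem avoidsPattern_reverse {f : Fin n → Fin n} {π : Equiv.Perm (Fin k)} :
    AvoidsPattern (fun x => f x.rev) (Fin.revPerm.trans π) ↔ AvoidsPattern f π := by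
  refine not_congr ⟨fun h => ?_, ContainsPattern.reverse⟩
  have hπ : Fin.revPerm.trans (Fin.revPerm.trans π) = π := by ext; simp
  simpa [hπ] using h.reverse

theorem latinAvoiding_complement {L : Fin n → Fin n → Fin n} {π : Equiv.Perm (Fin k)} :
    LatinAvoiding (π.trans Fin.revPerm) (fun i j => (L i j).rev) ↔ LatinAvoiding π L := by
  have hb (f : Fin n → Fin n) :
      (Function.Bijective fun x => (f x).rev) ↔ Function.Bijective f :=
    Fin.revPerm.comp_bijective f
  simp only [LatinAvoiding, IsLatinSquare, LatinAvoids, avoidsPattern_complement, hb]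

theorem latinAvoiding_reverse {L : Fin n → Fin n → Fin n} {π : Equiv.Perm (Fin k)} :
    LatinAvoiding (Fin.revPerm.trans π) (fun i j : Fin n => L i.rev j.rev) ↔ LatinAvoiding π L := by
  have hb (f : Fin n → Fin n) :
      (Function.Bijective fun x : Fin n => f x.rev) ↔ Function.Bijective f :=
    Fin.revPerm.bijective_comp f
  have hr (p : Fin n → Prop) : (∀ i : Fin n, p i.rev) ↔ ∀ i, p i :=
    Fin.revPerm.forall_congr_right
  unfold LatinAvoiding IsLatinSquare LatinAvoids
  rw [← hr fun i => Function.Bijective fun j => L i j,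
    ← hr fun j => Function.Bijective fun i => L i j,
    ← hr fun i => AvoidsPattern (fun j => L i j) π,
    ← hr fun j => AvoidsPattern (fun i => L i j) π]
  simp only [← hb fun j => L _ j, ← hb fun i => L i _,
    ← avoidsPattern_reverse (f := fun j => L _ j), ← avoidsPattern_reverse (f := fun i => L i _)]

theorem card_latinAvoiding_complement (π : Equiv.Perm (Fin k)) :
    Nat.card {L : Fin n → Fin n → Fin n // LatinAvoiding (π.trans Fin.revPerm) L} =
      Nat.card {L : Fin n → Fin n → Fin n // LatinAvoiding π L} :=
  (Nat.card_congr (((Equiv.refl (Fin n)).arrowCongr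
    ((Equiv.refl (Fin n)).arrowCongr Fin.revPerm)).subtypeEquiv
      fun _ => latinAvoiding_complement.symm)).symm

theorem card_latinAvoiding_reverse (π : Equiv.Perm (Fin k)) :
    Nat.card {L : Fin n → Fin n → Fin n // LatinAvoiding (Fin.revPerm.trans π) L} =
      Nat.card {L : Fin n → Fin n → Fin n // LatinAvoiding π L} :=
  (Nat.card_congr ((Fin.revPerm.arrowCongr
    (Fin.revPerm.arrowCongr (Equiv.refl (Fin n)))).subtypeEquiv
      fun _ => latinAvoiding_reverse.symm)).symm

end Symmetries

section Patterns

variable {n : ℕ} {f : Fin n → Fin n} {a b c : Fin n}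

theorem strictMono_vecCons_three (hab : a < b) (hbc : b < c) : StrictMono ![a, b, c] := by
  rw [Fin.strictMono_iff_lt_succ]
  intro i
  fin_cases i <;> assumption

theorem AvoidsPattern.not_lt_of_pat132 (h : AvoidsPattern f pat132) (hab : a < b) (hbc : b < c)
    (hac : f a < f c) : ¬ f c < f b := by
  refine fun hcb => h ⟨![a, b, c], strictMono_vecCons_three hab hbc, fun s t => ?_⟩
  fin_cases s <;> fin_cases t <;>
    simp [pat132, hac, hcb, hac.trans hcb, hac.le, hcb.le, (hac.trans hcb).le]

theorem AvoidsPattern.not_lt_of_pat321 (h : AvoidsPattern f pat321) (hab : a < b) (hbc : b < c)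
    (hba : f b < f a) : ¬ f c < f b := by
  refine fun hcb => h ⟨![a, b, c], strictMono_vecCons_three hab hbc, fun s t => ?_⟩
  fin_cases s <;> fin_cases t <;>
    simp [pat321, hba, hcb, hcb.trans hba, hba.le, hcb.le, (hcb.trans hba).le]

theorem avoidsPattern_add_pat132 (c : Fin n) : AvoidsPattern (fun j => c + j) pat132 := by
  rintro ⟨idx, hm, h⟩
  have h01 : idx 0 < idx 1 := hm (by decide)
  have h12 : idx 1 < idx 2 := hm (by decide)
  have h02 := (h 0 2).2 (by decide)
  have h21 := (h 2 1).2 (by decide)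
  simp only [Fin.lt_def, Fin.val_add_eq_ite] at *
  split_ifs at * <;> omega

theorem avoidsPattern_add_pat321 (c : Fin n) : AvoidsPattern (fun j => c + j) pat321 := by
  rintro ⟨idx, hm, h⟩
  have h01 : idx 0 < idx 1 := hm (by decide)
  have h12 : idx 1 < idx 2 := hm (by decide)
  have h10 := (h 1 0).2 (by decide)
  have h21 := (h 2 1).2 (by decide)
  simp only [Fin.lt_def, Fin.val_add_eq_ite] at *
  split_ifs at * <;> omega

end Patterns

section Rows

theorem Fin.eq_add_iff_val {n : ℕ} {v a b : Fin n} :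
    v = a + b ↔ v.val = a.val + b.val ∨ v.val + n = a.val + b.val := by
  rw [Fin.ext_iff, Fin.val_add_eq_ite]
  split_ifs <;> omega

variable {n : ℕ} [NeZero n] {L : Fin n → Fin n → Fin n} {f : Fin n → Fin n}

theorem AvoidsPattern.apply_eq_add_of_pat321 (h : AvoidsPattern f pat321)
    (hf : Function.Bijective f) {j : Fin n} (hlt : ∀ k < j, f k = f 0 + k)
    (hcol : ∀ y, f 0 < y → f j ≠ y + j) : f j = f 0 + j := by
  by_contra hne
  have hj0 : 0 < j := Fin.pos_iff_ne_zero.2 fun hj => hne (by simp [hj])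
  have hrow (k : Fin n) (hk : k < j) : f j ≠ f 0 + k := fun heq =>
    hk.ne' (hf.1 (heq.trans (hlt k hk).symm))
  have hlater (w : Fin n) (hw : ∀ k < j, w ≠ f 0 + k) (hwj : w < f j) : f 0 ≤ f j := by
    obtain ⟨k, rfl⟩ := hf.2 w
    have hjk : j < k := lt_of_le_of_ne
      (not_lt.1 fun hk => hw k hk (hlt k hk)) (fun hjk => by simp [hjk] at hwj)
    exact not_lt.1 fun hj => h.not_lt_of_pat321 hj0 hjk hj hwj
  generalize f j = v at *
  generalize f 0 = x at *
  obtain ⟨y, hy⟩ : ∃ y, v = y + j := ⟨v - j, by simp⟩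
  have hyx := hcol y
  obtain ⟨w, hw⟩ : ∃ w, w = x + j := ⟨_, rfl⟩
  simp only [Fin.eq_add_iff_val, Fin.lt_def, Fin.le_def, ne_eq, Fin.val_zero] at *
  have hvx : v.val < x.val := by
    by_contra hxv
    have := hrow ⟨v.val - x.val, by omega⟩
    simp only at this
    omega
  by_cases hxj : x.val + j.val < n
  · have := hlater 0 (fun k hk => by rw [Fin.val_zero]; omega) (by rw [Fin.val_zero]; omega)
    omega
  · have := hlater w (fun k hk => by omega) (by
      by_contra hwv
      have := hrow ⟨v.val + n - x.val, by omega⟩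
      simp only at this
      omega)
    omega

theorem AvoidsPattern.apply_eq_add_of_pat132 (h : AvoidsPattern f pat132)
    (hf : Function.Bijective f) {j : Fin n} (hlt : ∀ k, j < k → f k = f 0 + k)
    (hcol : ∀ y < f 0, f j ≠ y + j) : f j = f 0 + j := by
  by_contra hne
  have hj0 : 0 < j := Fin.pos_iff_ne_zero.2 fun hj => hne (by simp [hj])
  have hv0 : f j ≠ f 0 := fun h0 => hj0.ne' (hf.1 h0)
  have hrow (k : Fin n) (hk : j < k) : f j ≠ f 0 + k := fun heq =>
    hk.ne (hf.1 (heq.trans (hlt k hk).symm))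
  have hearlier (w : Fin n) (hw : ∀ k, j < k → w ≠ f 0 + k) (hwj : f j < w) (hw0 : w ≠ f 0) :
      f j ≤ f 0 := by
    obtain ⟨k, rfl⟩ := hf.2 w
    have hkj : k < j := lt_of_le_of_ne
      (not_lt.1 fun hk => hw k hk (hlt k hk)) (fun hjk => by simp [hjk] at hwj)
    have hk0 : 0 < k := Fin.pos_iff_ne_zero.2 fun hk => hw0 (by rw [hk])
    exact not_lt.1 fun hj => h.not_lt_of_pat132 hk0 hkj hj hwj
  generalize f j = v at *
  generalize f 0 = x at *
  obtain ⟨y, hy⟩ : ∃ y, v = y + j := ⟨v - j, by simp⟩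
  have hxy := hcol y
  obtain ⟨w, hw⟩ : ∃ w, w = x + j := ⟨_, rfl⟩
  simp only [Fin.eq_add_iff_val, Fin.lt_def, Fin.le_def, ne_eq, Fin.val_zero] at *
  rw [Fin.ext_iff] at hv0
  have hvx : x.val < v.val := by
    by_contra hxv
    have := hrow ⟨v.val + n - x.val, by omega⟩
    simp only at this
    omega
  by_cases hxj : x.val + j.val < n
  · have := hearlier w (fun k hk => by omega) (by
      by_contra hwv
      have := hrow ⟨v.val - x.val, by omega⟩
      simp only at this
      omega) (by omega)
    omega
  · have := hearlier ⟨n - 1, by omega⟩ (fun k hk => by simp only; omega) (by simp only; omega)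
      (by rw [Fin.ext_iff]; simp only; omega)
    omega

theorem IsLatinSquare.apply_ne_of_apply_zero_ne (hL : IsLatinSquare L) {i j y : Fin n}
    (hy : ∀ k, L k 0 = y → L k j = y + j) (hi : L i 0 ≠ y) : L i j ≠ y + j := by
  obtain ⟨k, hk⟩ := (hL.2 0).2 y
  rintro heq
  obtain rfl : i = k := (hL.2 j).1 (heq.trans (hy k hk).symm)
  exact hi hk

theorem IsLatinSquare.eq_add_of_rows_avoid_pat321 (hL : IsLatinSquare L)
    (h : ∀ i, AvoidsPattern (fun j => L i j) pat321) (i j : Fin n) : L i j = L i 0 + j := by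
  suffices H : ∀ x i, L i 0 = x → ∀ j, L i j = x + j from H _ i rfl j
  intro x
  induction x using WellFoundedGT.induction with
  | ind x ihx =>
  rintro i rfl j
  induction j using WellFoundedLT.induction with
  | ind j ihj =>
  exact (h i).apply_eq_add_of_pat321 (hL.1 i) ihj fun y hy =>
    hL.apply_ne_of_apply_zero_ne (fun k hk => ihx y hy k hk j) hy.ne

theorem IsLatinSquare.eq_add_of_rows_avoid_pat132 (hL : IsLatinSquare L)
    (h : ∀ i, AvoidsPattern (fun j => L i j) pat132) (i j : Fin n) : L i j = L i 0 + j := by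
  suffices H : ∀ x i, L i 0 = x → ∀ j, L i j = x + j from H _ i rfl j
  intro x
  induction x using WellFoundedLT.induction with
  | ind x ihx =>
  rintro i rfl j
  induction j using WellFoundedGT.induction with
  | ind j ihj =>
  exact (h i).apply_eq_add_of_pat132 (hL.1 i) ihj fun y hy =>
    hL.apply_ne_of_apply_zero_ne (fun k hk => ihx y hy k hk j) hy.ne'

end Rows

section Cyclic

variable {n : ℕ} [NeZero n] {π : Equiv.Perm (Fin 3)}

theorem latinAvoiding_iff_exists_eq_add
    (hπ : ∀ c : Fin n, AvoidsPattern (fun j => c + j) π)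
    (hrow : ∀ L : Fin n → Fin n → Fin n, IsLatinSquare L →
      (∀ i, AvoidsPattern (fun j => L i j) π) → ∀ i j, L i j = L i 0 + j)
    (L : Fin n → Fin n → Fin n) :
    LatinAvoiding π L ↔ ∃ c : Fin n, (fun i j => c + i + j) = L := by
  constructor
  · rintro ⟨hL, hr, hc⟩
    refine ⟨L 0 0, funext₂ fun i j => ?_⟩
    rw [hrow L hL hr i j, hrow (fun j i => L i j) hL.symm hc 0 i]
  · rintro ⟨c, rfl⟩
    have hcol (j : Fin n) : (fun i => c + i + j) = fun i => c + j + i :=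
      funext fun i => add_right_comm c i j
    exact ⟨⟨fun i => AddGroup.addLeft_bijective _,
      fun j => hcol j ▸ AddGroup.addLeft_bijective _⟩, fun i => hπ _, fun j => hcol j ▸ hπ _⟩

theorem card_latinAvoiding_of_rows
    (hπ : ∀ c : Fin n, AvoidsPattern (fun j => c + j) π)
    (hrow : ∀ L : Fin n → Fin n → Fin n, IsLatinSquare L →
      (∀ i, AvoidsPattern (fun j => L i j) π) → ∀ i j, L i j = L i 0 + j) :
    Nat.card {L : Fin n → Fin n → Fin n // LatinAvoiding π L} = n := by
  have hinj : Function.Injective fun c i j : Fin n => c + i + j := fun c d hcd => by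
    simpa using congrFun₂ hcd 0 0
  rw [Nat.card_congr (Equiv.subtypeEquivRight (latinAvoiding_iff_exists_eq_add hπ hrow))]
  exact (Nat.card_congr (Equiv.ofInjective _ hinj)).symm.trans (Nat.card_fin n)

end Cyclic

/-- For every n ≥ 1 and every pattern π of length 3, the number of Latin squares of
order n avoiding π (in all rows and columns) is exactly n. -/
theorem latin_avoiding_length_three_card (n : ℕ) (hn : 1 ≤ n) (π : Equiv.Perm (Fin 3)) :
    Nat.card {L : Fin n → Fin n → Fin n // IsLatinSquare L ∧ LatinAvoids L π} = n := by
  have : NeZero n := ⟨by omega⟩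
  change Nat.card {L : Fin n → Fin n → Fin n // LatinAvoiding π L} = n
  have h132 := card_latinAvoiding_of_rows (n := n) avoidsPattern_add_pat132
    fun _ => IsLatinSquare.eq_add_of_rows_avoid_pat132
  have h321 := card_latinAvoiding_of_rows (n := n) avoidsPattern_add_pat321
    fun _ => IsLatinSquare.eq_add_of_rows_avoid_pat321
  have hcases : π = pat132 ∨ π = pat321 ∨ π = pat132.trans Fin.revPerm ∨
      π = pat321.trans Fin.revPerm ∨ π = Fin.revPerm.trans pat132 ∨
      π = (Fin.revPerm.trans pat132).trans Fin.revPerm := by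
    revert π
    decide
  rcases hcases with rfl | rfl | rfl | rfl | rfl | rfl <;>
    simp only [card_latinAvoiding_complement, card_latinAvoiding_reverse, h132, h321]
end

section
/- For every n ≥ 1 and every permutation σ of Fin n, there exists exactly one Latin square of order n whose first row equals σ and all of whose columns avoid the pattern 123 (the increasing pattern of length 3). -/
/-- Avoiding 123 means having no increasing subsequence of length 3. -/
theorem avoidsPattern_pat123_iff {n : ℕ} (f : Fin n → Fin n) :
    AvoidsPattern f pat123 ↔ ∀ i j k, i < j → j < k → f i < f j → ¬ f j < f k := by
  constructor
  · intro h i j k hij hjk hf hg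
    refine h ⟨![i, j, k], ?_, ?_⟩
    · rw [Fin.strictMono_iff_lt_succ]
      intro a
      fin_cases a
      · exact hij
      · exact hjk
    · have hm : StrictMono fun a => f (![i, j, k] a) := by
        rw [Fin.strictMono_iff_lt_succ]
        intro a
        fin_cases a
        · exact hf
        · exact hg
      intro a b
      exact hm.lt_iff_lt
  · rintro h ⟨idx, hm, hp⟩
    have h01 : (0 : Fin 3) < 1 := by decide
    have h12 : (1 : Fin 3) < 2 := by decide
    exact h _ _ _ (hm h01) (hm h12) ((hp 0 1).2 h01) ((hp 1 2).2 h12)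

theorem Fin.val_sub_eq_ite {n : ℕ} (a b : Fin (n + 1)) :
    (a - b).val = if b.val ≤ a.val then a.val - b.val else n + 1 + a.val - b.val := by
  split_ifs with h
  · exact Fin.sub_val_of_le h
  · exact Fin.coe_sub_iff_lt.2 (not_le.1 h)

/-- The columns `i ↦ v - i` are unions of two decreasing runs, so they avoid 123. -/
theorem avoidsPattern_const_sub {n : ℕ} (v : Fin (n + 1)) :
    AvoidsPattern (fun i => v - i) pat123 := by
  rw [avoidsPattern_pat123_iff]
  intro i j k hij hjk h1 h2
  simp only [Fin.lt_def, Fin.val_sub_eq_ite] at *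
  split_ifs at * <;> omega

/-- If `p v x` is the row of the symbol `x` in the column with top entry `v`, and the symbols
larger than `v` occur in decreasing order in that column, then `p v x` is `v - x` modulo `n`. -/
theorem position_eq_of_decreasing {n : ℕ} {p : ℕ → ℕ → ℕ}
    (lt : ∀ v < n, ∀ x < n, p v x < n)
    (diag : ∀ v < n, p v v = 0)
    (col : ∀ v < n, ∀ x < n, ∀ y < n, p v x = p v y → x = y)
    (row : ∀ x < n, ∀ v < n, ∀ w < n, p v x = p w x → v = w)
    (dec : ∀ v x y, v < x → x < y → y < n → p v y < p v x) :
    ∀ v < n, ∀ x < n, p v x = if x ≤ v then v - x else n + v - x := by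
  have upper : ∀ v k, v + 1 + k < n → p v (v + 1 + k) + k < n := by
    intro v k
    induction k with
    | zero => exact fun h => lt v (by omega) _ h
    | succ k ih =>
      intro h
      have h1 := ih (by omega)
      have h2 := dec v (v + 1 + k) (v + 1 + (k + 1)) (by omega) (by omega) h
      omega
  have le : ∀ v x, v < x → x < n → p v x ≤ n + v - x := by
    intro v x hv hx
    have h := upper v (x - (v + 1)) (by omega)
    rw [show v + 1 + (x - (v + 1)) = x by omega] at h
    omega
  have top : ∀ v, v < n - 1 → p v (n - 1) = v + 1 := by
    intro v
    induction v using Nat.strong_induction_on with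
    | _ v ih =>
      intro hv
      have h1 := le v (n - 1) hv (by omega)
      by_contra hne
      rcases Nat.eq_zero_or_pos (p v (n - 1)) with h0 | h0
      · have := row (n - 1) (by omega) v (by omega) (n - 1) (by omega)
          (h0.trans (diag _ (by omega)).symm)
        omega
      · have h2 := ih (p v (n - 1) - 1) (by omega) (by omega)
        have := row (n - 1) (by omega) v (by omega) (p v (n - 1) - 1) (by omega) (by omega)
        omega
  suffices H : ∀ d x, x + d + 1 = n → ∀ v < n, p v x = if x ≤ v then v - x else n + v - x from
    fun v hv x hx => H (n - 1 - x) x (by omega) v hv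
  intro d
  induction d using Nat.strong_induction_on with
  | _ d ih =>
    intro x hx
    have above : ∀ v < n, ∀ y < n, x < y → p v y = if y ≤ v then v - y else n + v - y :=
      fun v hv y hy hxy => ih (n - 1 - y) (by omega) y (by omega) v hv
    have left : ∀ v < x, p v x = n + v - x := by
      intro v hv
      rcases Nat.eq_zero_or_pos d with hd | hd
      · have h := top v (by omega)
        rw [show n - 1 = x by omega] at h
        omega
      · have h1 := le v x hv (by omega)
        have h2 := dec v x (x + 1) hv (by omega) (by omega)
        rw [above v (by omega) (x + 1) (by omega) (by omega), if_neg (by omega)] at h2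
        omega
    have right : ∀ e v, v + e + 1 = n → x < v → p v x = v - x := by
      intro e
      induction e using Nat.strong_induction_on with
      | _ e ihe =>
        intro v hv hxv
        have hlt := lt v (by omega) x (by omega)
        by_contra hne
        rcases Nat.lt_or_ge (p v x) (v - x) with h | h
        · have h1 := above v (by omega) (v - p v x) (by omega) (by omega)
          rw [if_pos (by omega)] at h1
          have := col v (by omega) x (by omega) (v - p v x) (by omega) (by omega)
          omega
        · rcases Nat.lt_or_ge (p v x + x) n with h2 | h2
          · have h3 := ihe (n - 1 - (p v x + x)) (by omega) (p v x + x) (by omega) (by omega)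
            have := row x (by omega) v (by omega) (p v x + x) h2 (by omega)
            omega
          · have h3 := left (p v x + x - n) (by omega)
            have := row x (by omega) v (by omega) (p v x + x - n) (by omega) (by omega)
            omega
    intro v hv
    rcases Nat.lt_trichotomy v x with h | rfl | h
    · rw [left v h, if_neg (by omega)]
    · simp [diag v hv]
    · rw [right (n - 1 - v) v (by omega) h, if_pos h.le]

/-- The cyclic Latin square with first row `σ` whose columns descend cyclically. -/
theorem isLatinSquare_sub {n : ℕ} (σ : Equiv.Perm (Fin (n + 1))) :
    IsLatinSquare fun i j => σ j - i :=
  ⟨fun i => (Equiv.subRight i).bijective.comp σ.bijective,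
    fun j => (Equiv.subLeft (σ j)).bijective⟩

theorem IsLatinSquare.eq_sub_of_columns_avoid {n : ℕ} {σ : Equiv.Perm (Fin (n + 1))}
    {L : Fin (n + 1) → Fin (n + 1) → Fin (n + 1)} (hL : IsLatinSquare L)
    (h0 : ∀ j, L 0 j = σ j) (hav : ∀ j, AvoidsPattern (fun i => L i j) pat123)
    (i j : Fin (n + 1)) : L i j = σ j - i := by
  simp only [avoidsPattern_pat123_iff] at hav
  have hex : ∀ v x : Fin (n + 1), ∃ i, L i (σ.symm v) = x := fun v => (hL.2 (σ.symm v)).2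
  choose q hq using hex
  have diag : ∀ v, q v v = 0 := fun v =>
    (hL.2 (σ.symm v)).1 ((hq v v).trans (by simp [h0]))
  have col : ∀ v x y, q v x = q v y → x = y := fun v x y h => by
    rw [← hq v x, h, hq]
  have row : ∀ x v w, q v x = q w x → v = w := fun x v w h =>
    σ.symm.injective ((hL.1 (q v x)).1 ((hq v x).trans (by simp only [h, hq])))
  have dec : ∀ v x y, v < x → x < y → q v y < q v x := by
    intro v x y hvx hxy
    by_contra! hle
    have hpos : 0 < q v x := by
      rw [Fin.pos_iff_ne_zero]
      exact fun h => hvx.ne (col v v x ((diag v).trans h.symm))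
    refine hav (σ.symm v) 0 (q v x) (q v y) hpos
      (hle.lt_of_ne fun h => hxy.ne (col v x y h)) ?_ ?_
    · simpa [h0, hq] using hvx
    · simpa [hq] using hxy
  let p : ℕ → ℕ → ℕ := fun v x => (q (Fin.ofNat (n + 1) v) (Fin.ofNat (n + 1) x)).val
  have key : ∀ v x : Fin (n + 1), p v x = (q v x).val := fun v x => by simp [p]
  have hp := position_eq_of_decreasing (n := n + 1) (p := p)
    (fun v _ x _ => (q _ _).isLt)
    (fun v hv => by rw [key ⟨v, hv⟩ ⟨v, hv⟩, diag]; rfl)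
    (fun v hv x hx y hy h => by
      rw [key ⟨v, hv⟩ ⟨x, hx⟩, key ⟨v, hv⟩ ⟨y, hy⟩] at h
      exact congrArg Fin.val (col _ _ _ (Fin.ext h)))
    (fun x hx v hv w hw h => by
      rw [key ⟨v, hv⟩ ⟨x, hx⟩, key ⟨w, hw⟩ ⟨x, hx⟩] at h
      exact congrArg Fin.val (row _ _ _ (Fin.ext h)))
    (fun v x y hvx hxy hy => by
      rw [key ⟨v, by omega⟩ ⟨x, by omega⟩, key ⟨v, by omega⟩ ⟨y, hy⟩]
      exact dec _ _ _ hvx hxy)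
    (σ j) (σ j).isLt (σ j - i : Fin (n + 1)) (σ j - i).isLt
  have hi : q (σ j) (σ j - i) = i := by
    refine Fin.ext ?_
    rw [← key, hp, Fin.val_sub_eq_ite]
    split_ifs <;> omega
  have h := hq (σ j) (σ j - i)
  rwa [hi, σ.symm_apply_apply] at h

/-- For every n ≥ 1 and permutation σ of Fin n, there is exactly one Latin square of order n
with first row σ all of whose columns avoid 123. -/
theorem existsUnique_latin_column_123_avoiding_with_first_row (n : ℕ) (hn : 1 ≤ n)
    (σ : Equiv.Perm (Fin n)) :
    ∃! L : Fin n → Fin n → Fin n, IsLatinSquare L ∧ (∀ j, L ⟨0, hn⟩ j = σ j) ∧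
      ∀ j, AvoidsPattern (fun i => L i j) pat123 := by
  obtain ⟨n, rfl⟩ := Nat.exists_eq_add_of_le' hn
  refine ⟨fun i j => σ j - i, ⟨isLatinSquare_sub σ, fun j => sub_zero (σ j),
    fun j => avoidsPattern_const_sub (σ j)⟩, ?_⟩
  rintro L ⟨hL, h0, hav⟩
  funext i j
  exact hL.eq_sub_of_columns_avoid h0 hav i j
end

section
/- If L is a Latin square of order n all of whose columns avoid the pattern 123, then every entry of L is one less (mod n) than the entry directly above it: for all rows i with i+1 < n and all columns j, L(i+1, j) ≡ L(i, j) − 1 (mod n). Consequently each column has the form i, i−1, …, 1, n, n−1, …, i+1 when symbols are read as {1,…,n}. -/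
/-- Three increasing positions with increasing values form the pattern 123. -/
lemma AvoidsPattern.not_lt_of_pat123 {n : ℕ} {f : Fin n → Fin n} (hf : AvoidsPattern f pat123)
    {x y z : Fin n} (hxy : x < y) (hyz : y < z) (hfxy : f x < f y) : ¬ f y < f z := by
  intro hfyz
  have hxz := hxy.trans hyz
  have hfxz := hfxy.trans hfyz
  refine hf ⟨![x, y, z], ?_, ?_⟩
  · intro a b hab
    fin_cases a <;> fin_cases b <;> simp_all
  · intro a b
    fin_cases a <;> fin_cases b <;>
      simp [pat123, hfxy, hfyz, hfxz, hfxy.le, hfyz.le, hfxz.le]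

/-- `b` is the cyclic predecessor of `a` in `Fin n`, in terms of the underlying naturals. -/
def IsCyclicPred {n : ℕ} (a b : Fin n) : Prop :=
  (b : ℕ) + 1 = a ∨ ((a : ℕ) = 0 ∧ (b : ℕ) + 1 = n)

lemma IsCyclicPred.eq_sub {n : ℕ} {a b : Fin n} (h : IsCyclicPred a b) (hn : 1 < n) :
    b = a - ⟨1, hn⟩ := by
  apply Fin.ext
  have ha := a.isLt
  have hb := b.isLt
  rw [Fin.sub_def]
  rcases h with h | ⟨h₀, h⟩
  · have : n - 1 + (a : ℕ) = b + n := by omega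
    simp [this, Nat.mod_eq_of_lt hb]
  · have : n - 1 + (a : ℕ) = b := by omega
    simp [this, Nat.mod_eq_of_lt hb]

/-- If every entry of a row either decreases or becomes maximal in the next row, then every
entry is followed by its cyclic predecessor. -/
lemma isCyclicPred_of_lt_or_max {n : ℕ} {a b : Fin n → Fin n} (ha : Function.Surjective a)
    (hb : Function.Injective b) (h : ∀ j, b j < a j ∨ (b j : ℕ) + 1 = n) (j : Fin n) :
    IsCyclicPred (a j) (b j) := by
  have key : ∀ (v : ℕ) (j : Fin n), (a j : ℕ) = v → IsCyclicPred (a j) (b j) := by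
    intro v
    induction v using Nat.strong_induction_on with
    | _ v ih =>
      intro j hj
      have hlt := (a j).isLt
      rcases Nat.eq_zero_or_pos v with rfl | hv
      · rcases h j with h' | h'
        · rw [Fin.lt_def] at h'
          omega
        · exact Or.inr ⟨hj, h'⟩
      · by_contra hne
        have hstep : (b j : ℕ) + 1 < v ∨ (b j : ℕ) + 1 = n := by
          rcases h j with h' | h'
          · rw [Fin.lt_def] at h'
            rcases Nat.lt_or_ge ((b j : ℕ) + 1) v with h'' | h''
            · exact Or.inl h''
            · exact absurd (Or.inl (by omega)) hne
          · exact Or.inr h'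
        obtain ⟨u, hu, hub⟩ : ∃ u < v, (u = (b j : ℕ) + 1 ∨ (u = 0 ∧ (b j : ℕ) + 1 = n)) := by
          rcases hstep with h' | h'
          · exact ⟨_, h', Or.inl rfl⟩
          · exact ⟨0, hv, Or.inr ⟨rfl, h'⟩⟩
        obtain ⟨k, hk⟩ := ha ⟨u, by omega⟩
        have hku : (a k : ℕ) = u := by rw [hk]
        have hbk : b k = b j := by
          apply Fin.ext
          rcases ih u hu k hku with h' | ⟨_, h'⟩ <;> omega
        rw [hb hbk] at hku
        omega
  exact key _ j rfl

/-- In a 123-avoiding column that follows the cyclic predecessor rule up to row `i`, an ascent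
from row `i` to row `i + 1` reaches the maximal symbol. -/
lemma lt_or_max_of_avoids_pat123 {n : ℕ} {f : Fin n → Fin n} (hf : AvoidsPattern f pat123)
    (hbij : Function.Bijective f) {i : ℕ} (hi : i + 1 < n)
    (hpred : ∀ r (hr : r < i), IsCyclicPred (f ⟨r, by omega⟩) (f ⟨r + 1, by omega⟩)) :
    f ⟨i + 1, hi⟩ < f ⟨i, by omega⟩ ∨ (f ⟨i + 1, hi⟩ : ℕ) + 1 = n := by
  by_contra! hcon
  obtain ⟨hle, hmax⟩ := hcon
  have hlt : f ⟨i, by omega⟩ < f ⟨i + 1, hi⟩ := by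
    refine lt_of_le_of_ne hle fun he => ?_
    have := congrArg Fin.val (hbij.injective he)
    simp at this
  have hwn := (f ⟨i + 1, hi⟩).isLt
  obtain ⟨⟨k, hkn⟩, hk⟩ := hbij.surjective ⟨n - 1, by omega⟩
  have hki : k < i := by
    by_contra! hge
    rcases Nat.lt_trichotomy k (i + 1) with h | h | h
    · obtain rfl : k = i := by omega
      rw [hk, Fin.lt_def] at hlt
      simp only at hlt
      omega
    · subst h
      rw [hk] at hmax
      simp only at hmax
      omega
    · refine hf.not_lt_of_pat123 (x := ⟨i, by omega⟩) (y := ⟨i + 1, hi⟩) (z := ⟨k, hkn⟩)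
        (by simp [Fin.lt_def]) (by simpa [Fin.lt_def] using h) hlt ?_
      rw [hk, Fin.lt_def]
      simp only
      omega
  have hrun : ∀ t (ht : k + t ≤ i), (f ⟨k + t, by omega⟩ : ℕ) + t + 1 = n := by
    intro t
    induction t with
    | zero =>
      intro _
      simp only [Nat.add_zero, hk]
      omega
    | succ t ih =>
      intro ht
      have h₁ := ih (by omega)
      have h₂ := hpred (k + t) (by omega)
      simp only [← Nat.add_assoc] at *
      rcases h₂ with h₂ | ⟨h₂, _⟩ <;> omega
  have hend := hrun (i - k) (by omega)
  simp only [Nat.add_sub_cancel' hki.le] at hend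
  rw [Fin.lt_def] at hlt
  have hw := hrun (n - 1 - f ⟨i + 1, hi⟩) (by omega)
  have heq : f ⟨k + (n - 1 - f ⟨i + 1, hi⟩), by omega⟩ = f ⟨i + 1, hi⟩ := by
    apply Fin.ext
    omega
  have := congrArg Fin.val (hbij.injective heq)
  simp only at this
  omega

/-- In a Latin square whose columns avoid 123, each entry is one less (mod n) than the
entry directly above it; consequently each column is the cyclic decreasing sequence
starting at its top entry. (Subtraction is the mod-n subtraction of `Fin n`.) -/
theorem latin_column_123_avoiding_structure (n : ℕ) (L : Fin n → Fin n → Fin n)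
    (hL : IsLatinSquare L) (hA : ∀ j, AvoidsPattern (fun i => L i j) pat123) :
    (∀ (i : ℕ) (h : i + 1 < n) (j : Fin n),
      L ⟨i + 1, h⟩ j = L ⟨i, Nat.lt_of_succ_lt h⟩ j - ⟨1, by omega⟩) ∧
    ∀ (i j : Fin n), L i j = L ⟨0, i.pos⟩ j - i := by
  have hpred : ∀ (i : ℕ) (h : i + 1 < n) (j : Fin n),
      IsCyclicPred (L ⟨i, Nat.lt_of_succ_lt h⟩ j) (L ⟨i + 1, h⟩ j) := by
    intro i
    induction i using Nat.strong_induction_on with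
    | _ i ih =>
      intro h
      exact isCyclicPred_of_lt_or_max (hL.1 _).surjective (hL.1 _).injective fun j =>
        lt_or_max_of_avoids_pat123 (hA j) (hL.2 j) h fun r hr => ih r hr (by omega) j
  have hstep : ∀ (i : ℕ) (h : i + 1 < n) (j : Fin n),
      L ⟨i + 1, h⟩ j = L ⟨i, Nat.lt_of_succ_lt h⟩ j - ⟨1, by omega⟩ :=
    fun i h j => (hpred i h j).eq_sub (by omega)
  refine ⟨hstep, ?_⟩
  rintro ⟨i, hi⟩ j
  have : NeZero n := ⟨by omega⟩
  induction i with
  | zero => exact (sub_zero _).symm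
  | succ i ih =>
    have hsucc : (⟨i + 1, hi⟩ : Fin n) = ⟨i, by omega⟩ + ⟨1, by omega⟩ := by
      apply Fin.ext
      simp [Fin.add_def, Nat.mod_eq_of_lt hi]
    rw [hstep i hi j, ih (by omega), hsucc, sub_sub]
end

section
/- For any Latin square L of order n, the following are equivalent: some row or column of L contains the pattern 123; some row or column of L contains the pattern 231; some row or column of L contains the pattern 312. In other words, a Latin square contains either all of the patterns {123, 231, 312} or none of them. -/
/-- Some row map or some column map of `L` contains the pattern `π`. -/
def LatinContains {n k : ℕ} (L : Fin n → Fin n → Fin n) (π : Equiv.Perm (Fin k)) : Prop :=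
  (∃ i, ContainsPattern (fun j => L i j) π) ∨ ∃ j, ContainsPattern (fun i => L i j) π

/-- `f` is a cyclic rotation of the decreasing sequence: `f j + j` is constant modulo `n`. -/
def IsCyclicDecreasing {n : ℕ} (f : Fin n → Fin n) : Prop :=
  ∃ k < n, ∀ j, (f j : ℕ) + j = k ∨ (f j : ℕ) + j = k + n

lemma containsPattern_pat123_iff {n : ℕ} (f : Fin n → Fin n) :
    ContainsPattern f pat123 ↔ ∃ a b c, a < b ∧ b < c ∧ f a < f b ∧ f b < f c := by
  constructor
  · rintro ⟨idx, hmono, h⟩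
    exact ⟨idx 0, idx 1, idx 2, hmono (by decide), hmono (by decide),
      (h 0 1).2 (by decide), (h 1 2).2 (by decide)⟩
  · rintro ⟨a, b, c, hab, hbc, h₁, h₂⟩
    refine ⟨![a, b, c], ?_, ?_⟩
    · intro x y hxy
      fin_cases x <;> fin_cases y <;> simp_all
      omega
    · intro x y
      fin_cases x <;> fin_cases y <;> simp [pat123] <;> omega

lemma containsPattern_pat231_iff {n : ℕ} (f : Fin n → Fin n) :
    ContainsPattern f pat231 ↔ ∃ a b c, a < b ∧ b < c ∧ f c < f a ∧ f a < f b := by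
  constructor
  · rintro ⟨idx, hmono, h⟩
    exact ⟨idx 0, idx 1, idx 2, hmono (by decide), hmono (by decide),
      (h 2 0).2 (by decide), (h 0 1).2 (by decide)⟩
  · rintro ⟨a, b, c, hab, hbc, h₁, h₂⟩
    refine ⟨![a, b, c], ?_, ?_⟩
    · intro x y hxy
      fin_cases x <;> fin_cases y <;> simp_all
      omega
    · intro x y
      fin_cases x <;> fin_cases y <;> simp [pat231] <;> omega

lemma containsPattern_pat312_iff {n : ℕ} (f : Fin n → Fin n) :
    ContainsPattern f pat312 ↔ ∃ a b c, a < b ∧ b < c ∧ f b < f c ∧ f c < f a := by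
  constructor
  · rintro ⟨idx, hmono, h⟩
    exact ⟨idx 0, idx 1, idx 2, hmono (by decide), hmono (by decide),
      (h 1 2).2 (by decide), (h 2 0).2 (by decide)⟩
  · rintro ⟨a, b, c, hab, hbc, h₁, h₂⟩
    refine ⟨![a, b, c], ?_, ?_⟩
    · intro x y hxy
      fin_cases x <;> fin_cases y <;> simp_all
      omega
    · intro x y
      fin_cases x <;> fin_cases y <;> simp [pat312] <;> omega

namespace IsCyclicDecreasing

variable {n : ℕ} {f : Fin n → Fin n}

lemma avoids_pat123 (hf : IsCyclicDecreasing f) : AvoidsPattern f pat123 := by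
  obtain ⟨k, hk, h⟩ := hf
  rw [AvoidsPattern, containsPattern_pat123_iff]
  rintro ⟨a, b, c, hab, hbc, h₁, h₂⟩
  have := h a
  have := h b
  have := h c
  omega

lemma avoids_pat231 (hf : IsCyclicDecreasing f) : AvoidsPattern f pat231 := by
  obtain ⟨k, hk, h⟩ := hf
  rw [AvoidsPattern, containsPattern_pat231_iff]
  rintro ⟨a, b, c, hab, hbc, h₁, h₂⟩
  have := h a
  have := h b
  have := h c
  omega

lemma avoids_pat312 (hf : IsCyclicDecreasing f) : AvoidsPattern f pat312 := by
  obtain ⟨k, hk, h⟩ := hf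
  rw [AvoidsPattern, containsPattern_pat312_iff]
  rintro ⟨a, b, c, hab, hbc, h₁, h₂⟩
  have := h a
  have := h b
  have := h c
  omega

end IsCyclicDecreasing

lemma Function.Bijective.eq_of_forall_le {n : ℕ} {f g : Fin n → Fin n}
    (hf : Function.Bijective f) (hg : Function.Bijective g) (h : ∀ i, f i ≤ g i) : f = g := by
  have hsum : ∑ i, (f i : ℕ) = ∑ i, (g i : ℕ) :=
    (hf.sum_comp fun v : Fin n => (v : ℕ)).trans (hg.sum_comp fun v : Fin n => (v : ℕ)).symm
  have hle : ∀ i ∈ Finset.univ, (f i : ℕ) ≤ g i := fun i _ => h i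
  funext i
  exact Fin.ext ((Finset.sum_eq_sum_iff_of_le hle).1 hsum i (Finset.mem_univ i))

/-- If in every row of a Latin square the entries preceding the maximal symbol decrease, then
every row is a cyclic rotation of the decreasing sequence. -/
theorem IsLatinSquare.isCyclicDecreasing_of_decreasing_before_max {n : ℕ}
    {L : Fin n → Fin n → Fin n} (hL : IsLatinSquare L)
    (h : ∀ i a b c, a < b → b < c → (L i c : ℕ) + 1 = n → L i b < L i a) (i : Fin n) :
    IsCyclicDecreasing (L i) := by
  obtain _ | m := n
  · exact i.elim0
  choose p hp using fun i => (hL.1 i).2 (Fin.last m)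
  have hp_val (i) : (L i (p i) : ℕ) = m := by simpa using congrArg Fin.val (hp i)
  have hp_inj : Function.Injective p := fun i i' hii' =>
    (hL.2 (p i)).1 ((hp i).trans (hii' ▸ (hp i').symm))
  let g (j i : Fin (m + 1)) : Fin (m + 1) :=
    ⟨if j < p i then p i - 1 - j else p i + m - j, by split_ifs <;> omega⟩
  have hg_val (j i) : (g j i : ℕ) = if j < p i then (p i : ℕ) - 1 - j else p i + m - j := rfl
  have hg (j) : Function.Bijective (g j) := by
    refine Finite.injective_iff_bijective.1 fun i i' hii' => hp_inj (Fin.ext ?_)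
    have := congrArg Fin.val hii'
    rw [hg_val, hg_val] at this
    split_ifs at this <;> omega
  have key (j : ℕ) : ∀ hj : j < m + 1, ∀ i, L i ⟨j, hj⟩ = g ⟨j, hj⟩ i := by
    induction j using Nat.strong_induction_on with
    | _ j ih =>
    intro hj
    obtain rfl | hj0 := Nat.eq_zero_or_pos j
    · refine fun i => (congrFun ((hg _).eq_of_forall_le (hL.2 _) fun i => ?_) i).symm
      have hdec (b : ℕ) : ∀ hb : b < m + 1, b < p i → (L i ⟨b, hb⟩ : ℕ) + b ≤ L i ⟨0, hj⟩ := by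
        induction b with
        | zero => intros; simp
        | succ b ihb =>
          intro hb hbp
          have h₁ := ihb (by omega) (by omega)
          have h₂ := h i ⟨b, by omega⟩ ⟨b + 1, hb⟩ (p i) (by simp) hbp (by rw [hp_val])
          rw [Fin.lt_def] at h₂
          omega
      rw [Fin.le_def, hg_val]
      split_ifs with h0
      · have h0' : 0 < (p i : ℕ) := h0
        have := hdec (p i - 1) (by omega) (by omega)
        simp only
        omega
      · have h0' : p i = ⟨0, hj⟩ := Fin.ext (by rw [Fin.lt_def] at h0; simp only at h0 ⊢; omega)
        have := hp_val i
        rw [h0'] at this ⊢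
        simp only at this ⊢
        omega
    · refine fun i => congrFun ((hL.2 ⟨j, hj⟩).eq_of_forall_le (hg _) fun i => ?_) i
      rw [Fin.le_def, hg_val]
      split_ifs with hjp
      · have hjp' : j < p i := hjp
        have h₁ := congrArg Fin.val (ih (j - 1) (by omega) (by omega) i)
        rw [hg_val, if_pos (Fin.lt_def.2 (by simp only; omega))] at h₁
        have h₂ := h i ⟨j - 1, by omega⟩ ⟨j, hj⟩ (p i) (Fin.lt_def.2 (by simp only; omega)) hjp
          (by rw [hp_val])
        rw [Fin.lt_def] at h₂
        simp only at h₁ ⊢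
        omega
      · have hjp' : (p i : ℕ) ≤ j := by simpa [Fin.lt_def] using hjp
        by_contra! hlt
        simp only at hlt
        have hv := (L i ⟨j, hj⟩).isLt
        have h₁ := congrArg Fin.val
          (ih (p i + m - L i ⟨j, hj⟩) (by omega) (by omega) i)
        rw [hg_val, if_neg (by rw [Fin.lt_def]; simp only; omega)] at h₁
        have h₂ := congrArg Fin.val ((hL.1 i).1 (Fin.ext (h₁.trans (by simp only; omega)) :
          L i ⟨p i + m - L i ⟨j, hj⟩, by omega⟩ = L i ⟨j, hj⟩))
        simp only at h₂
        omega
  have hval (j : Fin (m + 1)) := (congrArg Fin.val (key j j.isLt i)).trans (hg_val j i)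
  obtain hp0 | hp0 := Nat.eq_zero_or_pos (p i : ℕ)
  · refine ⟨m, by omega, fun j => ?_⟩
    have := hval j
    rw [Fin.eta] at this
    split_ifs at this <;> omega
  · refine ⟨p i - 1, by omega, fun j => ?_⟩
    have := hval j
    rw [Fin.eta] at this
    split_ifs at this <;> omega

namespace IsLatinSquare

variable {n : ℕ} {L : Fin n → Fin n → Fin n}

lemma transpose (hL : IsLatinSquare L) : IsLatinSquare fun i j => L j i :=
  ⟨hL.2, hL.1⟩

lemma map_symbols (hL : IsLatinSquare L) (σ : Equiv.Perm (Fin n)) :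
    IsLatinSquare fun i j => σ (L i j) :=
  ⟨fun i => σ.bijective.comp (hL.1 i), fun j => σ.bijective.comp (hL.2 j)⟩

lemma map_columns (hL : IsLatinSquare L) (σ : Equiv.Perm (Fin n)) :
    IsLatinSquare fun i j => L i (σ j) :=
  ⟨fun i => (hL.1 i).comp σ.bijective, fun j => hL.2 (σ j)⟩

lemma isCyclicDecreasing_of_avoids_pat123 (hL : IsLatinSquare L)
    (h : ∀ i, AvoidsPattern (L i) pat123) (i : Fin n) : IsCyclicDecreasing (L i) := by
  refine hL.isCyclicDecreasing_of_decreasing_before_max (fun i a b c hab hbc hc => ?_) i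
  by_contra! hlt
  have hne₁ : L i a ≠ L i b := (hL.1 i).1.ne hab.ne
  have hne₂ : L i b ≠ L i c := (hL.1 i).1.ne hbc.ne
  exact h i ((containsPattern_pat123_iff _).2 ⟨a, b, c, hab, hbc, by omega, by omega⟩)

lemma isCyclicDecreasing_of_avoids_pat231 (hL : IsLatinSquare L)
    (h : ∀ i, AvoidsPattern (L i) pat231) (i : Fin n) : IsCyclicDecreasing (L i) := by
  obtain _ | m := n
  · exact i.elim0
  have hrot (v : Fin (m + 1)) : (v : ℕ) = 0 ∧ ((finRotate (m + 1)).symm v : ℕ) = m ∨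
      (v : ℕ) = ((finRotate (m + 1)).symm v : ℕ) + 1 := by
    obtain ⟨w, rfl⟩ := (finRotate (m + 1)).surjective v
    rw [Equiv.symm_apply_apply]
    obtain rfl | hw := eq_or_ne w (Fin.last m)
    · simp
    · exact Or.inr (coe_finRotate_of_ne_last hw)
  obtain ⟨k, hk, hcyc⟩ :=
    (hL.map_symbols (finRotate (m + 1)).symm).isCyclicDecreasing_of_decreasing_before_max
      (fun i a b c hab hbc hc => by
        by_contra! hlt
        have hne₁ : L i a ≠ L i b := (hL.1 i).1.ne hab.ne
        have hne₂ : L i b ≠ L i c := (hL.1 i).1.ne hbc.ne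
        have hne₃ : L i a ≠ L i c := (hL.1 i).1.ne (hab.trans hbc).ne
        have ha := hrot (L i a)
        have hb := hrot (L i b)
        have hc' := hrot (L i c)
        rw [Fin.le_def] at hlt
        exact h i ((containsPattern_pat231_iff _).2 ⟨a, b, c, hab, hbc, by omega, by omega⟩)) i
  obtain rfl | hkm := eq_or_ne k m
  · refine ⟨0, by omega, fun j => ?_⟩
    have hj := hcyc j
    have := hrot (L i j)
    simp only at hj
    omega
  · refine ⟨k + 1, by omega, fun j => ?_⟩
    have hj := hcyc j
    have := hrot (L i j)
    simp only at hj
    omega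

lemma isCyclicDecreasing_of_avoids_pat312 (hL : IsLatinSquare L)
    (h : ∀ i, AvoidsPattern (L i) pat312) (i : Fin n) : IsCyclicDecreasing (L i) := by
  obtain ⟨k, hk, hcyc⟩ :=
    ((hL.map_columns Fin.revPerm).map_symbols Fin.revPerm).isCyclicDecreasing_of_avoids_pat231
      (fun i hc => by
        obtain ⟨a, b, c, hab, hbc, h₁, h₂⟩ := (containsPattern_pat231_iff _).1 hc
        simp only [Fin.revPerm_apply, Fin.rev_lt_rev] at h₁ h₂
        exact h i ((containsPattern_pat312_iff _).2
          ⟨c.rev, b.rev, a.rev, Fin.rev_lt_rev.2 hbc, Fin.rev_lt_rev.2 hab, h₂, h₁⟩)) i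
  have hrev (j : Fin n) := hcyc j.rev
  simp only [Fin.revPerm_apply, Fin.rev_rev, Fin.val_rev] at hrev
  obtain rfl | hkn := eq_or_ne (k + 1) n
  · refine ⟨k, hk, fun j => ?_⟩
    have := hrev j
    omega
  · refine ⟨n - 2 - k, by omega, fun j => ?_⟩
    have := hrev j
    omega

end IsLatinSquare

lemma not_latinContains_iff_latinAvoids {n k : ℕ} (L : Fin n → Fin n → Fin n)
    (π : Equiv.Perm (Fin k)) : ¬ LatinContains L π ↔ LatinAvoids L π := by
  simp [LatinContains, LatinAvoids, AvoidsPattern]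

/-- If avoidance of `π` in all rows forces every Latin square to have cyclically decreasing rows,
and cyclically decreasing sequences avoid `τ`, then Latin squares containing `τ` contain `π`. -/
lemma IsLatinSquare.latinContains_of_latinContains {n k l : ℕ} {L : Fin n → Fin n → Fin n}
    (hL : IsLatinSquare L) {π : Equiv.Perm (Fin k)} {τ : Equiv.Perm (Fin l)}
    (hπ : ∀ {M : Fin n → Fin n → Fin n}, IsLatinSquare M → (∀ i, AvoidsPattern (M i) π) →
      ∀ i, IsCyclicDecreasing (M i))
    (hτ : ∀ {f : Fin n → Fin n}, IsCyclicDecreasing f → AvoidsPattern f τ)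
    (h : LatinContains L τ) : LatinContains L π := by
  contrapose! h
  rw [not_latinContains_iff_latinAvoids] at h ⊢
  exact ⟨fun i => hτ (hπ hL h.1 i), fun j => hτ (hπ hL.transpose h.2 j)⟩

/-- A Latin square contains either all of the patterns 123, 231, 312 (in some row or
column), or none of them. -/
theorem latin_contains_123_231_312_iff (n : ℕ) (L : Fin n → Fin n → Fin n)
    (hL : IsLatinSquare L) :
    (LatinContains L pat123 ↔ LatinContains L pat231) ∧
    (LatinContains L pat231 ↔ LatinContains L pat312) := by
  refine ⟨⟨?_, ?_⟩, ?_, ?_⟩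
  · exact hL.latinContains_of_latinContains
      IsLatinSquare.isCyclicDecreasing_of_avoids_pat231 IsCyclicDecreasing.avoids_pat123
  · exact hL.latinContains_of_latinContains
      IsLatinSquare.isCyclicDecreasing_of_avoids_pat123 IsCyclicDecreasing.avoids_pat231
  · exact hL.latinContains_of_latinContains
      IsLatinSquare.isCyclicDecreasing_of_avoids_pat312 IsCyclicDecreasing.avoids_pat231
  · exact hL.latinContains_of_latinContains
      IsLatinSquare.isCyclicDecreasing_of_avoids_pat231 IsCyclicDecreasing.avoids_pat312
end

section
/- For every n ≥ 1 and every permutation π of Fin n (a pattern whose length equals the order of the square), the number L_n(π) of Latin squares of order n avoiding π satisfies (n!)² · L_n(π) = (n! − n)² · L_n, where L_n is the total number of Latin squares of order n. -/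
/-- A strictly monotone self-map of `Fin n` is the identity. -/
lemma strictMono_fin_self_eq_id {n : ℕ} {f : Fin n → Fin n} (hf : StrictMono f) : f = id := by
  rw [← hf.range_inj strictMono_id]
  rw [(Finite.surjective_of_injective hf.injective).range_eq, Set.range_id]

/-- A bijection of `Fin n` contains a pattern of length `n` only if it equals that pattern. -/
lemma containsPattern_full_length_iff {n : ℕ} {f : Fin n → Fin n} (π : Equiv.Perm (Fin n)) :
    ContainsPattern f π ↔ f = π := by
  constructor
  · rintro ⟨idx, hidx, h⟩
    rw [strictMono_fin_self_eq_id hidx] at h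
    have hmono : StrictMono (f ∘ π.symm) := fun a b hab => by
      have := (h (π.symm a) (π.symm b)).2 (by simpa using hab)
      simpa using this
    have hid := strictMono_fin_self_eq_id hmono
    funext a
    simpa using congrFun hid (π a)
  · rintro rfl
    exact ⟨id, strictMono_id, fun _ _ => Iff.rfl⟩

lemma latinAvoids_full_length_iff {n : ℕ} {L : Fin n → Fin n → Fin n} (π : Equiv.Perm (Fin n)) :
    LatinAvoids L π ↔ ¬ (∃ i, ∀ j, L i j = π j) ∧ ¬ ∃ j, ∀ i, L i j = π i := by
  simp only [LatinAvoids, AvoidsPattern, containsPattern_full_length_iff, funext_iff, not_exists]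

lemma IsLatinSquare.transpose_s6 {n : ℕ} {L : Fin n → Fin n → Fin n} (hL : IsLatinSquare L) :
    IsLatinSquare fun i j => L j i :=
  ⟨hL.2, hL.1⟩

lemma IsLatinSquare.relabel {n : ℕ} {L : Fin n → Fin n → Fin n} (hL : IsLatinSquare L)
    (σ : Equiv.Perm (Fin n)) : IsLatinSquare fun i j => σ (L i j) :=
  ⟨fun i => σ.bijective.comp (hL.1 i), fun j => σ.bijective.comp (hL.2 j)⟩

lemma IsLatinSquare.permuteRows {n : ℕ} {L : Fin n → Fin n → Fin n} (hL : IsLatinSquare L)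
    (τ : Equiv.Perm (Fin n)) : IsLatinSquare fun i j => L (τ i) j :=
  ⟨fun i => hL.1 (τ i), fun j => (hL.2 j).comp τ.bijective⟩

open Classical in
/-- The finite set of Latin squares of order `n` satisfying `p`. -/
noncomputable def latinSquares (n : ℕ) (p : (Fin n → Fin n → Fin n) → Prop) :
    Finset (Fin n → Fin n → Fin n) :=
  {L | IsLatinSquare L ∧ p L}

lemma mem_latinSquares {n : ℕ} {p : (Fin n → Fin n → Fin n) → Prop}
    {L : Fin n → Fin n → Fin n} : L ∈ latinSquares n p ↔ IsLatinSquare L ∧ p L := by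
  simp [latinSquares]

/-- Relabelling symbols: each permutation is equally likely to be the `i`-th row. -/
lemma factorial_mul_card_row_eq {n : ℕ} (π : Equiv.Perm (Fin n)) (i : Fin n) :
    n.factorial * (latinSquares n fun L => ∀ j, L i j = π j).card =
      (latinSquares n fun _ => True).card := by
  have hc : (Finset.univ : Finset (Equiv.Perm (Fin n))).card = n.factorial := by
    rw [Finset.card_univ, Fintype.card_perm, Fintype.card_fin]
  rw [← hc, ← Finset.card_product]
  apply Finset.card_nbij fun x a b => x.1 (x.2 a b)
  · rintro ⟨σ, L⟩ h
    simp only [Finset.coe_product, Set.mem_prod, Finset.mem_coe, mem_latinSquares] at h ⊢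
    exact ⟨h.2.1.relabel σ, trivial⟩
  · rintro ⟨σ, L⟩ h ⟨σ', L'⟩ h' heq
    simp only [Finset.coe_product, Set.mem_prod, Finset.mem_coe, mem_latinSquares] at h h'
    simp only [funext_iff] at heq
    have hσ : σ = σ' := by
      ext b
      have := heq i (π.symm b)
      simp only [h.2.2, h'.2.2, Equiv.apply_symm_apply] at this
      rw [this]
    subst hσ
    congr 1
    funext a b
    exact σ.injective (heq a b)
  · intro L hL
    simp only [Finset.mem_coe, mem_latinSquares] at hL
    let ρ := Equiv.ofBijective _ (hL.1.1 i)
    have hρ : ∀ j, ρ.symm (L i j) = j := fun j => ρ.symm_apply_apply j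
    refine ⟨(π.symm.trans ρ, fun a b => (ρ.symm.trans π) (L a b)), ?_, ?_⟩
    · simp only [Finset.coe_product, Set.mem_prod, Finset.mem_coe, mem_latinSquares]
      exact ⟨Finset.mem_univ _, hL.1.relabel _, fun j => by simp [hρ]⟩
    · funext a b
      simp

/-- Permuting rows: among the Latin squares with some row equal to `π`, each permutation is equally
likely to be the `i`-th column. -/
lemma factorial_mul_card_row_col_eq {n : ℕ} (π : Equiv.Perm (Fin n)) (i : Fin n) :
    n.factorial * (latinSquares n fun L => (∀ j, L i j = π j) ∧ ∀ k, L k i = π k).card =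
      (latinSquares n fun L => ∃ k, ∀ j, L k j = π j).card := by
  have hc : (Finset.univ : Finset (Equiv.Perm (Fin n))).card = n.factorial := by
    rw [Finset.card_univ, Fintype.card_perm, Fintype.card_fin]
  rw [← hc, ← Finset.card_product]
  apply Finset.card_nbij fun x a b => x.2 (x.1 a) b
  · rintro ⟨τ, L⟩ h
    simp only [Finset.coe_product, Set.mem_prod, Finset.mem_coe, mem_latinSquares] at h ⊢
    exact ⟨h.2.1.permuteRows τ, τ.symm i, fun j => by simp [h.2.2.1]⟩
  · rintro ⟨τ, L⟩ h ⟨τ', L'⟩ h' heq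
    simp only [Finset.coe_product, Set.mem_prod, Finset.mem_coe, mem_latinSquares] at h h'
    simp only [funext_iff] at heq
    have hτ : τ = τ' := by
      ext a
      have := heq a i
      rw [h.2.2.2, h'.2.2.2] at this
      rw [π.injective this]
    subst hτ
    congr 1
    funext a b
    simpa using heq (τ.symm a) b
  · intro L hL
    simp only [Finset.mem_coe, mem_latinSquares] at hL
    obtain ⟨hL, k, hk⟩ := hL
    let c := Equiv.ofBijective _ (hL.2 i)
    have hcL : ∀ a, c a = L a i := fun _ => rfl
    have hki : c.symm (π i) = k := by rw [Equiv.symm_apply_eq, hcL, hk]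
    refine ⟨(c.trans π.symm, fun a b => L ((π.trans c.symm) a) b), ?_, ?_⟩
    · simp only [Finset.coe_product, Set.mem_prod, Finset.mem_coe, mem_latinSquares]
      refine ⟨Finset.mem_univ _, hL.permuteRows _, fun j => ?_, fun a => ?_⟩
      · rw [Equiv.trans_apply, hki, hk]
      · rw [← hcL]
        simp
    · funext a b
      simp

/-- The Latin squares satisfying one of `n` mutually exclusive properties. -/
lemma card_latinSquares_exists {n : ℕ} (p : Fin n → (Fin n → Fin n → Fin n) → Prop)
    (hp : ∀ L, IsLatinSquare L → ∀ i j, p i L → p j L → i = j) :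
    (latinSquares n fun L => ∃ i, p i L).card = ∑ i, (latinSquares n (p i)).card := by
  classical
  rw [← Finset.card_biUnion]
  · congr 1
    ext L
    simp [mem_latinSquares]
  · intro i _ j _ hij
    refine Finset.disjoint_left.2 fun L hi hj => ?_
    rw [mem_latinSquares] at hi hj
    exact hij (hp L hi.1 i j hi.2 hj.2)

/-- At most one row of a Latin square equals `π`. -/
lemma IsLatinSquare.row_unique {n : ℕ} {L : Fin n → Fin n → Fin n} (hL : IsLatinSquare L)
    {π : Equiv.Perm (Fin n)} {i k : Fin n} (hi : ∀ j, L i j = π j) (hk : ∀ j, L k j = π j) :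
    i = k :=
  (hL.2 i).injective ((hi i).trans (hk i).symm)

lemma factorial_mul_card_exists_row {n : ℕ} (π : Equiv.Perm (Fin n)) :
    n.factorial * (latinSquares n fun L => ∃ i, ∀ j, L i j = π j).card =
      n * (latinSquares n fun _ => True).card := by
  rw [card_latinSquares_exists _ fun L hL i k => hL.row_unique, Finset.mul_sum]
  simp [factorial_mul_card_row_eq]

lemma card_exists_col {n : ℕ} (π : Equiv.Perm (Fin n)) :
    (latinSquares n fun L => ∃ j, ∀ i, L i j = π i).card =
      (latinSquares n fun L => ∃ i, ∀ j, L i j = π j).card := by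
  apply Finset.card_nbij' (fun L i j => L j i) (fun L i j => L j i)
  · intro L hL
    simp only [Finset.mem_coe, mem_latinSquares] at hL ⊢
    exact ⟨hL.1.transpose_s6, hL.2⟩
  · intro L hL
    simp only [Finset.mem_coe, mem_latinSquares] at hL ⊢
    exact ⟨hL.1.transpose_s6, hL.2⟩
  · exact fun _ _ => rfl
  · exact fun _ _ => rfl

/-- If a row and a column of a square both equal `π`, they have the same index. -/
lemma exists_row_and_exists_col_iff {n : ℕ} (π : Equiv.Perm (Fin n)) (L : Fin n → Fin n → Fin n) :
    ((∃ i, ∀ j, L i j = π j) ∧ ∃ j, ∀ i, L i j = π i) ↔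
      ∃ i, (∀ j, L i j = π j) ∧ ∀ k, L k i = π k := by
  constructor
  · rintro ⟨⟨i, hi⟩, j, hj⟩
    obtain rfl : j = i := π.injective ((hi j).symm.trans (hj i))
    exact ⟨j, hi, hj⟩
  · rintro ⟨i, hi, hk⟩
    exact ⟨⟨i, hi⟩, i, hk⟩

lemma factorial_mul_card_exists_row_col {n : ℕ} (π : Equiv.Perm (Fin n)) :
    n.factorial *
        (latinSquares n fun L => (∃ i, ∀ j, L i j = π j) ∧ ∃ j, ∀ i, L i j = π i).card =
      n * (latinSquares n fun L => ∃ i, ∀ j, L i j = π j).card := by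
  simp only [exists_row_and_exists_col_iff]
  rw [card_latinSquares_exists _ fun L hL i k hi hk => hL.row_unique hi.1 hk.1, Finset.mul_sum]
  simp [factorial_mul_card_row_col_eq]

/-- Inclusion–exclusion for two properties of Latin squares. -/
lemma card_latinSquares_not_and_not {n : ℕ} (p q : (Fin n → Fin n → Fin n) → Prop) :
    (latinSquares n fun L => ¬ p L ∧ ¬ q L).card + (latinSquares n p).card +
        (latinSquares n q).card =
      (latinSquares n fun _ => True).card + (latinSquares n fun L => p L ∧ q L).card := by
  classical
  have hunion : latinSquares n p ∪ latinSquares n q = latinSquares n fun L => p L ∨ q L := by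
    ext L
    simp only [Finset.mem_union, mem_latinSquares]
    tauto
  have hinter : latinSquares n p ∩ latinSquares n q = latinSquares n fun L => p L ∧ q L := by
    ext L
    simp only [Finset.mem_inter, mem_latinSquares]
    tauto
  have hcompl : (latinSquares n fun _ => True) =
      (latinSquares n fun L => ¬ p L ∧ ¬ q L) ∪ latinSquares n fun L => p L ∨ q L := by
    ext L
    simp only [Finset.mem_union, mem_latinSquares]
    tauto
  have hdisj : Disjoint (latinSquares n fun L => ¬ p L ∧ ¬ q L)
      (latinSquares n fun L => p L ∨ q L) := by
    rw [Finset.disjoint_left]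
    intro L
    simp only [mem_latinSquares]
    tauto
  have h := Finset.card_union_add_card_inter (latinSquares n p) (latinSquares n q)
  rw [hunion, hinter] at h
  rw [hcompl, Finset.card_union_of_disjoint hdisj]
  omega

lemma natCard_subtype_isLatinSquare {n : ℕ} (p : (Fin n → Fin n → Fin n) → Prop) :
    Nat.card {L : Fin n → Fin n → Fin n // IsLatinSquare L ∧ p L} = (latinSquares n p).card := by
  classical
  rw [Nat.card_eq_fintype_card]
  exact Fintype.card_of_subtype _ fun _ => mem_latinSquares

/-- For π a pattern of length n, (n!)² · L_n(π) = (n! − n)² · L_n. -/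
theorem latin_avoiding_full_length_card (n : ℕ) (hn : 1 ≤ n) (π : Equiv.Perm (Fin n)) :
    (Nat.factorial n) ^ 2 * Nat.card {L : Fin n → Fin n → Fin n // IsLatinSquare L ∧ LatinAvoids L π} =
      (Nat.factorial n - n) ^ 2 * Nat.card {L : Fin n → Fin n → Fin n // IsLatinSquare L} := by
  have hall := natCard_subtype_isLatinSquare (n := n) fun _ => True
  simp only [and_true] at hall
  simp only [latinAvoids_full_length_iff]
  rw [hall, natCard_subtype_isLatinSquare]
  have hrow := factorial_mul_card_exists_row π
  have hboth := factorial_mul_card_exists_row_col π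
  have hie := card_latinSquares_not_and_not (n := n) (fun L => ∃ i, ∀ j, L i j = π j)
    (fun L => ∃ j, ∀ i, L i j = π i)
  rw [card_exists_col] at hie
  have hle : n ≤ n.factorial := Nat.self_le_factorial n
  zify [hle] at hrow hboth hie ⊢
  linear_combination (n.factorial : ℤ) ^ 2 * hie + (n - 2 * n.factorial : ℤ) * hrow +
    (n.factorial : ℤ) * hboth
end

section
/- Let m ≥ 1 and n ≥ (m−1)(m−2) + 2. Then every Latin square of order n has a row or a column containing a monotone subsequence of length m. -/
/-- `f` has a monotone (strictly increasing or strictly decreasing) subsequence of length `m`. -/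
def HasMonotoneSubseq {n : ℕ} (f : Fin n → Fin n) (m : ℕ) : Prop :=
  ∃ idx : Fin m → Fin n, StrictMono idx ∧ (StrictMono (f ∘ idx) ∨ StrictAnti (f ∘ idx))

theorem Finset.strictMonoOn_insert_of_lt {α β : Type*} [LinearOrder α] [LinearOrder β]
    {f : α → β} {T : Finset α} {y : α} (hT : StrictMonoOn f T)
    (hy : ∀ z ∈ T, y < z ∧ f y < f z) : StrictMonoOn f (insert y T : Finset α) := by
  intro a ha b hb hab
  rw [Finset.mem_coe, Finset.mem_insert] at ha hb
  rcases ha with rfl | ha <;> rcases hb with rfl | hb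
  · exact absurd hab (lt_irrefl _)
  · exact (hy b hb).2
  · exact absurd hab (hy a ha).1.not_gt
  · exact hT ha hb hab

/-- The Erdős–Szekeres theorem for an injective function on a finite set. -/
theorem Finset.exists_strictMonoOn_or_strictAntiOn {α β : Type*} [LinearOrder α] [LinearOrder β]
    {f : α → β} (s r : ℕ) (S : Finset α) (hf : Set.InjOn f S) (hS : r * s < S.card) :
    (∃ T ⊆ S, T.card = r + 1 ∧ StrictMonoOn f T) ∨
      ∃ T ⊆ S, T.card = s + 1 ∧ StrictAntiOn f T := by
  classical
  induction r generalizing S with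
  | zero =>
    obtain ⟨x, hx⟩ := Finset.card_pos.mp (Nat.zero_mul s ▸ hS)
    exact Or.inl ⟨{x}, by simpa using hx, by simp, by simp⟩
  | succ r ih =>
    -- the left-to-right minima of `f` on `S` form a decreasing subsequence
    set D := S.filter fun x => ∀ y ∈ S, y < x → ¬ f y < f x with hD
    have hDS : D ⊆ S := Finset.filter_subset _ _
    by_cases hcard : s + 1 ≤ D.card
    · obtain ⟨T, hTD, hT⟩ := Finset.exists_subset_card_eq hcard
      refine Or.inr ⟨T, hTD.trans hDS, hT, fun a ha b hb hab => ?_⟩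
      have haS := hDS (hTD ha)
      have hbD := Finset.mem_filter.mp (hTD hb)
      exact lt_of_le_of_ne (not_lt.mp (hbD.2 a haS hab))
        fun h => hab.ne' (hf hbD.1 haS h)
    · have hsub : S \ D ⊆ S := Finset.sdiff_subset
      have hlt : r * s < (S \ D).card := by
        rw [Finset.card_sdiff_of_subset hDS]
        rw [Nat.add_mul] at hS
        omega
      rcases ih (S \ D) (hf.mono (Finset.coe_subset.mpr hsub)) hlt with
        ⟨T, hTS, hT, hmono⟩ | ⟨T, hTS, hT, hanti⟩
      · have hne : T.Nonempty := Finset.card_pos.mp (by omega)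
        have hmin := T.min'_mem hne
        have hx := hTS hmin
        simp only [hD, Finset.mem_sdiff, Finset.mem_filter, not_and, not_forall, not_not] at hx
        obtain ⟨y, hyS, hyx, hfy⟩ := hx.2 hx.1
        have hy : ∀ z ∈ T, y < z ∧ f y < f z := fun z hz =>
          ⟨hyx.trans_le (T.min'_le z hz),
            hfy.trans_le (hmono.monotoneOn hmin hz (T.min'_le z hz))⟩
        have hyT : y ∉ T := fun h => lt_irrefl _ (hy y h).1
        exact Or.inl ⟨insert y T, Finset.insert_subset hyS (hTS.trans hsub),
          by rw [Finset.card_insert_of_notMem hyT, hT],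
          Finset.strictMonoOn_insert_of_lt hmono hy⟩
      · exact Or.inr ⟨T, hTS.trans hsub, hT, hanti⟩

theorem hasMonotoneSubseq_of_finset {n m : ℕ} {f : Fin n → Fin n} (T : Finset (Fin n))
    (hT : T.card = m) (h : StrictMonoOn f T ∨ StrictAntiOn f T) : HasMonotoneSubseq f m := by
  have hmem := T.orderEmbOfFin_mem hT
  have hmono := (T.orderEmbOfFin hT).strictMono
  exact ⟨T.orderEmbOfFin hT, hmono,
    h.imp (fun h a b hab => h (hmem a) (hmem b) (hmono hab))
      fun h a b hab => h (hmem a) (hmem b) (hmono hab)⟩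

/-- A sequence whose first entry is its least one has longer increasing subsequences than
the Erdős–Szekeres theorem gives: apply the theorem to the tail and prepend the first entry. -/
theorem hasMonotoneSubseq_of_apply_zero {n k : ℕ} [NeZero n] {f : Fin n → Fin n}
    (hf : Function.Injective f) (h0 : f 0 = 0) (hn : (k + 1) * k + 2 ≤ n) :
    HasMonotoneSubseq f (k + 2) := by
  have hcard : k * (k + 1) < (Finset.univ.erase (0 : Fin n)).card := by
    rw [Finset.card_erase_of_mem (Finset.mem_univ _), Finset.card_univ, Fintype.card_fin,
      Nat.mul_comm]
    omega
  rcases Finset.exists_strictMonoOn_or_strictAntiOn (k + 1) k _ hf.injOn hcard with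
    ⟨T, hTS, hT, hmono⟩ | ⟨T, -, hT, hanti⟩
  · have hpos : ∀ z ∈ T, 0 < z ∧ f 0 < f z := fun z hz => by
      have hz0 : z ≠ 0 := Finset.ne_of_mem_erase (hTS hz)
      refine ⟨Fin.pos_iff_ne_zero.mpr hz0, ?_⟩
      rw [h0]
      exact Fin.pos_iff_ne_zero.mpr fun h => hz0 (hf (h.trans h0.symm))
    have h0T : 0 ∉ T := fun h => lt_irrefl _ (hpos 0 h).1
    exact hasMonotoneSubseq_of_finset (insert 0 T)
      (by rw [Finset.card_insert_of_notMem h0T, hT])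
      (Or.inl (Finset.strictMonoOn_insert_of_lt hmono hpos))
  · exact hasMonotoneSubseq_of_finset T hT (Or.inr hanti)

/-- If n ≥ (m−1)(m−2)+2 then every Latin square of order n has a row or a column with a
monotone subsequence of length m. -/
theorem latin_monotone_subseq (m n : ℕ) (hm : 1 ≤ m) (hn : (m - 1) * (m - 2) + 2 ≤ n)
    (L : Fin n → Fin n → Fin n) (hL : IsLatinSquare L) :
    (∃ i, HasMonotoneSubseq (fun j => L i j) m) ∨
      ∃ j, HasMonotoneSubseq (fun i => L i j) m := by
  have : NeZero n := ⟨by omega⟩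
  left
  obtain ⟨i, hi⟩ := (hL.2 0).2 0
  refine ⟨i, ?_⟩
  obtain rfl | ⟨k, rfl⟩ : m = 1 ∨ ∃ k, m = k + 2 := by
    rcases hm.eq_or_lt with h | h
    · exact Or.inl h.symm
    · exact Or.inr ⟨m - 2, by omega⟩
  · exact hasMonotoneSubseq_of_finset {0} (by simp) (Or.inl (by simp))
  · exact hasMonotoneSubseq_of_apply_zero (hL.1 i).1 hi hn
end

section
/- For every n ≥ 1, there exists a Latin square of order n² in which no row and no column contains a monotone subsequence of length n + 2. (Hence, combined with the lower bound, the longest monotone subsequence forced in every Latin square of order n² has length exactly n + 1 for n ≥ 2.) -/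
/-- Swap the two lowest base-`n` digits of `t`, complementing the one that becomes the units digit.
The square has entry `digitSwap n (i + j)` in cell `(i, j)`. -/
def digitSwap (n t : ℕ) : ℕ := t % n * n + (n - 1 - t / n % n)

theorem digitSwap_lt {n : ℕ} (hn : 0 < n) (t : ℕ) : digitSwap n t < n ^ 2 := by
  have h : (t % n + 1) * n ≤ n * n := Nat.mul_le_mul_right n (Nat.mod_lt t hn)
  rw [add_mul] at h
  unfold digitSwap
  rw [sq]
  omega

theorem digitSwap_lt_digitSwap_iff {n : ℕ} (hn : 0 < n) (t u : ℕ) :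
    digitSwap n t < digitSwap n u ↔
      t % n < u % n ∨ t % n = u % n ∧ u / n % n < t / n % n := by
  have ht := Nat.mod_lt (t / n) hn
  have hu := Nat.mod_lt (u / n) hn
  unfold digitSwap
  rcases lt_trichotomy (t % n) (u % n) with h | h | h
  · have := Nat.mul_le_mul_right n (Nat.succ_le_of_lt h)
    rw [Nat.succ_mul] at this
    omega
  · rw [h]
    omega
  · have := Nat.mul_le_mul_right n (Nat.succ_le_of_lt h)
    rw [Nat.succ_mul] at this
    omega

theorem modEq_sq_of_digitSwap_eq {n : ℕ} (hn : 0 < n) {t u : ℕ}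
    (h : digitSwap n t = digitSwap n u) : t ≡ u [MOD n ^ 2] := by
  have h₁ := digitSwap_lt_digitSwap_iff hn t u
  have h₂ := digitSwap_lt_digitSwap_iff hn u t
  have hlow : t % n = u % n := by omega
  have hhigh : t / n % n = u / n % n := by omega
  rw [Nat.ModEq, sq, Nat.mod_mul, Nat.mod_mul, hlow, hhigh]

theorem mod_add_div_sq_lt_of_digitSwap_lt {n : ℕ} (hn : 0 < n) {t u : ℕ} (htu : t < u)
    (h : digitSwap n t < digitSwap n u) : t % n + t / n ^ 2 < u % n + u / n ^ 2 := by
  have hdiv : t / n ^ 2 ≤ u / n ^ 2 := Nat.div_le_div_right htu.le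
  rcases (digitSwap_lt_digitSwap_iff hn t u).1 h with hlow | ⟨hlow, hhigh⟩
  · omega
  · suffices t / n ^ 2 ≠ u / n ^ 2 by omega
    intro hq
    rw [sq, ← Nat.div_div_eq_div_mul, ← Nat.div_div_eq_div_mul] at hq
    have hle : t / n ≤ u / n := Nat.div_le_div_right htu.le
    have ht := Nat.div_add_mod (t / n) n
    have hu := Nat.div_add_mod (u / n) n
    rw [hq] at ht
    omega

theorem div_lt_div_of_digitSwap_lt {n : ℕ} (hn : 0 < n) {t u : ℕ} (htu : t < u)
    (h : digitSwap n u < digitSwap n t) : t / n < u / n := by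
  refine lt_of_le_of_ne (Nat.div_le_div_right htu.le) fun hq => ?_
  have ht := Nat.div_add_mod t n
  have hu := Nat.div_add_mod u n
  rw [hq] at ht
  rw [digitSwap_lt_digitSwap_iff hn, hq] at h
  omega

theorem StrictMono.card_le_of_mem_Icc {m c d : ℕ} {g : Fin m → ℕ} (hg : StrictMono g)
    (hb : ∀ a, g a ∈ Finset.Icc c (c + d)) : m ≤ d + 1 := by
  have h := Finset.card_le_card_of_injOn (s := Finset.univ) g (fun a _ => hb a) hg.injective.injOn
  rw [Finset.card_univ, Fintype.card_fin, Nat.card_Icc] at h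
  omega

theorem not_hasMonotoneSubseq_digitSwap {n : ℕ} (hn : 0 < n) (i : Fin (n ^ 2)) :
    ¬ HasMonotoneSubseq
      (fun j : Fin (n ^ 2) => (⟨digitSwap n (i + j), digitSwap_lt hn _⟩ : Fin (n ^ 2)))
      (n + 2) := by
  rintro ⟨idx, hidx, hinc | hdec⟩
  · have hg : StrictMono fun a => (i + idx a : ℕ) % n + (i + idx a : ℕ) / n ^ 2 := fun a b hab =>
      mod_add_div_sq_lt_of_digitSwap_lt hn (Nat.add_lt_add_left (hidx hab) _) (hinc hab)
    have := hg.card_le_of_mem_Icc (c := 0) (d := n) fun a => by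
      have hmod := Nat.mod_lt (i + idx a : ℕ) hn
      have hdiv : (i + idx a : ℕ) / n ^ 2 < 2 := Nat.div_lt_of_lt_mul (by omega)
      exact Finset.mem_Icc.2 ⟨Nat.zero_le _, by omega⟩
    omega
  · have hg : StrictMono fun a => (i + idx a : ℕ) / n := fun a b hab =>
      div_lt_div_of_digitSwap_lt hn (Nat.add_lt_add_left (hidx hab) _) (hdec hab)
    have := hg.card_le_of_mem_Icc (c := i / n) (d := n) fun a => by
      rw [Finset.mem_Icc, ← Nat.add_mul_div_right _ _ hn, ← sq]
      exact ⟨Nat.div_le_div_right (by omega), Nat.div_le_div_right (by omega)⟩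
    omega

theorem digitSwap_add_bijective {n : ℕ} (hn : 0 < n) (i : Fin (n ^ 2)) :
    Function.Bijective
      (fun j : Fin (n ^ 2) => (⟨digitSwap n (i + j), digitSwap_lt hn _⟩ : Fin (n ^ 2))) := by
  rw [← Finite.injective_iff_bijective]
  intro j k hjk
  have h := modEq_sq_of_digitSwap_eq hn (Fin.mk.inj hjk)
  exact Fin.ext ((Nat.ModEq.add_left_cancel' _ h).eq_of_lt_of_lt j.isLt k.isLt)

/-- For every n ≥ 1 there is a Latin square of order n² in which no row and no column has a
monotone subsequence of length n + 2. -/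
theorem exists_latin_order_sq_no_long_monotone_subseq (n : ℕ) (hn : 1 ≤ n) :
    ∃ L : Fin (n ^ 2) → Fin (n ^ 2) → Fin (n ^ 2), IsLatinSquare L ∧
      (∀ i, ¬ HasMonotoneSubseq (fun j => L i j) (n + 2)) ∧
      ∀ j, ¬ HasMonotoneSubseq (fun i => L i j) (n + 2) := by
  refine ⟨fun i j => ⟨digitSwap n (i + j), digitSwap_lt hn _⟩,
    ⟨digitSwap_add_bijective hn, fun j => ?_⟩, not_hasMonotoneSubseq_digitSwap hn, fun j => ?_⟩
  · simpa only [add_comm] using digitSwap_add_bijective hn j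
  · simpa only [add_comm] using not_hasMonotoneSubseq_digitSwap hn j
end

section
/- For every n ≥ 1, the number of Latin squares of order n all of whose columns avoid the pattern 123 and all of whose rows avoid the pattern 321 is exactly n. -/
/-- A function avoiding 321 has no three decreasing values. -/
theorem AvoidsPattern.not_decreasing {n : ℕ} {f : Fin n → Fin n} (h : AvoidsPattern f pat321)
    {a b c : Fin n} (hab : a < b) (hbc : b < c) (h1 : f b < f a) (h2 : f c < f b) : False := by
  refine h ⟨![a, b, c], ?_, ?_⟩
  · rw [Fin.strictMono_iff_lt_succ]
    intro i
    fin_cases i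
    · exact hab
    · exact hbc
  · intro x y
    fin_cases x <;> fin_cases y <;> simp [pat321] <;> order

/-- A function avoiding 123 has no three increasing values. -/
theorem AvoidsPattern.not_increasing {n : ℕ} {f : Fin n → Fin n} (h : AvoidsPattern f pat123)
    {a b c : Fin n} (hab : a < b) (hbc : b < c) (h1 : f a < f b) (h2 : f b < f c) : False := by
  refine h ⟨![a, b, c], ?_, ?_⟩
  · rw [Fin.strictMono_iff_lt_succ]
    intro i
    fin_cases i
    · exact hab
    · exact hbc
  · intro x y
    fin_cases x <;> fin_cases y <;> simp [pat123] <;> order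

theorem avoidsPattern_pat321_of_forall {n : ℕ} {f : Fin n → Fin n}
    (h : ∀ a b c, a < b → b < c → f b < f a → f c < f b → False) : AvoidsPattern f pat321 := by
  rintro ⟨idx, hm, hp⟩
  exact h (idx 0) (idx 1) (idx 2) (hm (by decide)) (hm (by decide))
    ((hp 1 0).2 (by decide)) ((hp 2 1).2 (by decide))

theorem avoidsPattern_pat123_of_forall {n : ℕ} {f : Fin n → Fin n}
    (h : ∀ a b c, a < b → b < c → f a < f b → f b < f c → False) : AvoidsPattern f pat123 := by
  rintro ⟨idx, hm, hp⟩
  exact h (idx 0) (idx 1) (idx 2) (hm (by decide)) (hm (by decide))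
    ((hp 0 1).2 (by decide)) ((hp 1 2).2 (by decide))

/-- A 321-avoiding permutation `f` is the rotation of the identity starting with `s = f 0`,
provided it meets no rotation starting with a value larger than `s`. -/
theorem val_eq_add_or_of_avoids {n : ℕ} {f : Fin n → Fin n} (hf : Function.Bijective f)
    (hav : AvoidsPattern f pat321) {s : ℕ} (hn : 0 < n) (h0 : (f ⟨0, hn⟩).val = s)
    (hne : ∀ (j : Fin n) (t : ℕ), s < t → t < n →
      (f j).val ≠ t + j.val ∧ (f j).val + n ≠ t + j.val) (j : Fin n) :
    (f j).val = s + j.val ∨ (f j).val + n = s + j.val := by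
  obtain ⟨j, hj⟩ := j
  induction j using Nat.strong_induction_on with
  | _ j ih =>
    by_contra hcon
    dsimp only at hcon ih
    have hs : s < n := h0 ▸ (f ⟨0, hn⟩).isLt
    have hv : (f ⟨j, hj⟩).val < n := (f ⟨j, hj⟩).isLt
    have hj0 : 0 < j := by
      rcases Nat.eq_zero_or_pos j with rfl | h
      · omega
      · exact h
    have hdiff : ∀ (k : ℕ) (hk : k < j), (f ⟨k, hk.trans hj⟩).val ≠ (f ⟨j, hj⟩).val := by
      intro k hk h
      have := congrArg Fin.val (hf.1 (Fin.ext h))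
      simp at this
      omega
    have key : j ≤ (f ⟨j, hj⟩).val ∧ (f ⟨j, hj⟩).val < s := by
      have e1 := hne ⟨j, hj⟩ ((f ⟨j, hj⟩).val - j)
      have e2 := hne ⟨j, hj⟩ ((f ⟨j, hj⟩).val + n - j)
      dsimp only at e1 e2
      have e3 : ∀ k, k < j → (s + k ≠ (f ⟨j, hj⟩).val) ∧ (s + k ≠ (f ⟨j, hj⟩).val + n) := by
        intro k hk
        have := ih k hk (hk.trans hj)
        have := hdiff k hk
        have := (f ⟨k, hk.trans hj⟩).isLt
        omega
      have e4 := e3 ((f ⟨j, hj⟩).val - s)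
      have e5 := e3 ((f ⟨j, hj⟩).val + n - s)
      omega
    obtain ⟨⟨k, hk⟩, hfk⟩ := hf.2 ⟨s + j - n, by omega⟩
    have hfk' : (f ⟨k, hk⟩).val = s + j - n := by rw [hfk]
    have hjk : j < k := by
      rcases lt_trichotomy k j with h | rfl | h
      · have := ih k h hk
        omega
      · omega
      · exact h
    refine hav.not_decreasing (a := ⟨0, hn⟩) (b := ⟨j, hj⟩) (c := ⟨k, hk⟩) hj0 hjk ?_ ?_
    · rw [Fin.lt_def]; omega
    · rw [Fin.lt_def]; omega

/-- In a Latin square whose rows avoid 321, each row is a rotation of the identity. -/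
theorem IsLatinSquare.row_eq_rotation {n : ℕ} {L : Fin n → Fin n → Fin n}
    (hL : IsLatinSquare L) (hav : ∀ i, AvoidsPattern (fun j => L i j) pat321) (hn : 0 < n)
    (i j : Fin n) :
    (L i j).val = (L i ⟨0, hn⟩).val + j.val ∨ (L i j).val + n = (L i ⟨0, hn⟩).val + j.val := by
  induction hd : n - (L i ⟨0, hn⟩).val using Nat.strong_induction_on generalizing i j with
  | _ d ih =>
    refine val_eq_add_or_of_avoids (hL.1 i) (hav i) hn rfl ?_ j
    intro j t hst htn
    obtain ⟨i', hi'⟩ := (hL.2 ⟨0, hn⟩).2 ⟨t, htn⟩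
    have hi'v : (L i' ⟨0, hn⟩).val = t := congrArg Fin.val hi'
    have hrow := ih (n - t) (by omega) i' j (by rw [hi'v])
    rw [hi'v] at hrow
    have hii : (L i j).val ≠ (L i' j).val := by
      intro h
      have : i = i' := (hL.2 j).1 (Fin.ext h)
      subst this
      omega
    have h1 := (L i j).isLt
    have h2 := (L i' j).isLt
    omega

/-- A 123-avoiding permutation starting with its minimum decreases afterwards. -/
theorem val_add_eq_of_avoids_pat123 {n : ℕ} {f : Fin n → Fin n} (hf : Function.Bijective f)
    (hav : AvoidsPattern f pat123) (hn : 0 < n) (h0 : (f ⟨0, hn⟩).val = 0) (i : Fin n)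
    (hi : 0 < i.val) : (f i).val + i.val = n := by
  have hpos : ∀ k : Fin n, 0 < k.val → 0 < (f k).val := by
    intro k hk
    rcases Nat.eq_zero_or_pos (f k).val with h | h
    · have := congrArg Fin.val (hf.1 (Fin.ext (h.trans h0.symm)))
      simp at this
      omega
    · exact h
  have hdec : ∀ a b : Fin n, 0 < a.val → a < b → (f b).val < (f a).val := by
    intro a b ha hab
    by_contra hcon
    have hneq : (f a).val ≠ (f b).val := fun h => hab.ne (hf.1 (Fin.ext h))
    refine hav.not_increasing (a := ⟨0, hn⟩) (b := a) (c := b) ha hab ?_ ?_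
    · have := hpos a ha
      rw [Fin.lt_def]; omega
    · rw [Fin.lt_def]; omega
  have upper : ∀ (k : ℕ) (hk : k < n), 0 < k → (f ⟨k, hk⟩).val + k ≤ n := by
    intro k
    induction k with
    | zero => omega
    | succ k ih =>
      intro hk _
      rcases Nat.eq_zero_or_pos k with rfl | h
      · have := (f ⟨0 + 1, hk⟩).isLt
        omega
      · have h1 := ih (by omega) h
        have h2 := hdec ⟨k, by omega⟩ ⟨k + 1, hk⟩ h (Nat.lt_succ_self k)
        omega
  have lower : ∀ (d k : ℕ) (hk : k < n), 0 < k → k + d + 1 = n → d + 1 ≤ (f ⟨k, hk⟩).val := by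
    intro d
    induction d with
    | zero => exact fun k hk h _ => hpos ⟨k, hk⟩ h
    | succ d ih =>
      intro k hk h hkd
      have h1 := ih (k + 1) (by omega) (by omega) (by omega)
      have h2 := hdec ⟨k, hk⟩ ⟨k + 1, by omega⟩ h (Nat.lt_succ_self k)
      omega
  have h1 := upper i.val i.isLt hi
  have h2 := lower (n - i.val - 1) i.val i.isLt hi (by omega)
  simp only [Fin.eta] at h1 h2
  omega

/-- The entries of the cyclic square with corner `a`: a value `v` at row `i` and column `j`
with `v + i` congruent to `a + j` modulo `n`. -/
def IsCyclicEntry (n a i j v : ℕ) : Prop :=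
  v + i = a + j ∨ v + i = a + j + n ∨ v + i + n = a + j

theorem isCyclicEntry_mod {n a i j : ℕ} (ha : a < n) (hi : i < n) (hj : j < n) :
    IsCyclicEntry n a i j ((a + j + (n - i)) % n) := by
  unfold IsCyclicEntry
  have hlt := Nat.mod_lt (a + j + (n - i)) (show 0 < n by omega)
  have hdiv := Nat.div_add_mod (a + j + (n - i)) n
  have hq : (a + j + (n - i)) / n < 3 := Nat.div_lt_of_lt_mul (by omega)
  interval_cases (a + j + (n - i)) / n <;> omega

theorem isCyclicEntry_of_avoids {n : ℕ} {L : Fin n → Fin n → Fin n} (hL : IsLatinSquare L)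
    (hcol : ∀ j, AvoidsPattern (fun i => L i j) pat123)
    (hrow : ∀ i, AvoidsPattern (fun j => L i j) pat321) (hn : 0 < n) (i j : Fin n) :
    IsCyclicEntry n (L ⟨0, hn⟩ ⟨0, hn⟩).val i.val j.val (L i j).val := by
  unfold IsCyclicEntry
  obtain ⟨k, hk⟩ := (hL.1 ⟨0, hn⟩).2 ⟨0, hn⟩
  have hk0 : (L ⟨0, hn⟩ k).val = 0 := congrArg Fin.val hk
  have h1 := hL.row_eq_rotation hrow hn i j
  have h2 := hL.row_eq_rotation hrow hn i k
  have h3 := hL.row_eq_rotation hrow hn ⟨0, hn⟩ k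
  have h4 := val_add_eq_of_avoids_pat123 (hL.2 k) (hcol k) hn hk0 i
  have b1 := (L i j).isLt
  have b2 := (L i k).isLt
  have b3 := (L i ⟨0, hn⟩).isLt
  have b4 := (L ⟨0, hn⟩ ⟨0, hn⟩).isLt
  rcases Nat.eq_zero_or_pos i.val with h | h
  · have hi : i = ⟨0, hn⟩ := Fin.ext h
    subst hi
    dsimp only
    omega
  · have := h4 h
    omega

theorem isLatinSquare_and_avoids_of_isCyclicEntry {n a : ℕ} {L : Fin n → Fin n → Fin n}
    (h : ∀ i j, IsCyclicEntry n a i.val j.val (L i j).val) :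
    IsLatinSquare L ∧ (∀ j, AvoidsPattern (fun i => L i j) pat123) ∧
      ∀ i, AvoidsPattern (fun j => L i j) pat321 := by
  unfold IsCyclicEntry at h
  refine ⟨⟨fun i => Finite.injective_iff_bijective.1 ?_,
    fun j => Finite.injective_iff_bijective.1 ?_⟩, fun j => avoidsPattern_pat123_of_forall ?_,
    fun i => avoidsPattern_pat321_of_forall ?_⟩
  · intro x y hxy
    have hxy' := congrArg Fin.val hxy
    have := h i x
    have := h i y
    ext
    dsimp only at hxy'
    omega
  · intro x y hxy
    have hxy' := congrArg Fin.val hxy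
    have := h x j
    have := h y j
    ext
    dsimp only at hxy'
    omega
  · intro x y z hxy hyz h1 h2
    have := h x j
    have := h y j
    have := h z j
    simp only [Fin.lt_def] at *
    omega
  · intro x y z hxy hyz h1 h2
    have := h i x
    have := h i y
    have := h i z
    simp only [Fin.lt_def] at *
    omega

/-- The number of Latin squares of order n ≥ 1 whose columns all avoid 123 and whose rows
all avoid 321 is exactly n. -/
theorem latin_columns_avoid_123_rows_avoid_321_card (n : ℕ) (hn : 1 ≤ n) :
    Nat.card {L : Fin n → Fin n → Fin n //
      IsLatinSquare L ∧ (∀ j, AvoidsPattern (fun i => L i j) pat123) ∧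
        ∀ i, AvoidsPattern (fun j => L i j) pat321} = n := by
  have hn : 0 < n := hn
  refine (Nat.card_eq_of_bijective (fun L => L.1 ⟨0, hn⟩ ⟨0, hn⟩) ⟨?_, ?_⟩).trans
    (Nat.card_fin n)
  · rintro ⟨L, hL, hLc, hLr⟩ ⟨M, hM, hMc, hMr⟩ h
    have h' : (L ⟨0, hn⟩ ⟨0, hn⟩).val = (M ⟨0, hn⟩ ⟨0, hn⟩).val := congrArg Fin.val h
    refine Subtype.ext (funext fun i => funext fun j => Fin.ext ?_)
    have h1 := isCyclicEntry_of_avoids hL hLc hLr hn i j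
    have h2 := isCyclicEntry_of_avoids hM hMc hMr hn i j
    unfold IsCyclicEntry at h1 h2
    dsimp only
    omega
  · intro a
    refine ⟨⟨fun i j => ⟨(a.val + j.val + (n - i.val)) % n, Nat.mod_lt _ hn⟩,
      isLatinSquare_and_avoids_of_isCyclicEntry (a := a.val)
        fun i j => isCyclicEntry_mod a.isLt i.isLt j.isLt⟩, Fin.ext ?_⟩
    simp [Nat.mod_eq_of_lt a.isLt]
end
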